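/- Fix an integer k ≥ 2 and constants 0 < c < C. There exists a constant C̃ > 0 (depending only on k, c, C) such that for all sufficiently large real N and every compact convex set D ⊂ ℝ^k satisfying [-cN,cN]^k ⊆ D ⊆ [-CN,CN]^k, the absolute value of the integral of g(t_1·t_2·⋯·t_k) over the set D \ [-cN,cN]^k with respect to Lebesgue measure is at most C̃·(log N)^{k-2}. -/

import Mathlib

open MeasureTheory Real

/-- `g u = sin u / u`, extended by `g 0 = 1`. -/
noncomputable def g (u : ℝ) : ℝ := if u = 0 then 1 else Real.sin u / u

lemma g_eq_sinc : g = Real.sinc := rfl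

lemma continuous_g : Continuous g := Real.continuous_sinc

lemma abs_g_le_one (x : ℝ) : |g x| ≤ 1 := Real.abs_sinc_le_one x

lemma abs_integral_g_le_abs_sub (a b : ℝ) : |∫ u in a..b, g u| ≤ |b - a| := by
  simpa using intervalIntegral.norm_integral_le_of_norm_le_const (a := a) (b := b) (f := g) (C := 1)
    fun x _ => abs_g_le_one x

lemma hasDerivAt_integral_g (x : ℝ) : HasDerivAt (fun y => ∫ u in (0 : ℝ)..y, g u) (g x) x :=
  (continuous_g.integral_hasStrictDerivAt 0 x).hasDerivAt

lemma hasDerivAt_integral_g_add {x : ℝ} (hx : x ≠ 0) (e : ℝ) :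
    HasDerivAt (fun y => (∫ u in (0 : ℝ)..y, g u) + (cos y + e) / y) (-(cos x + e) / x ^ 2) x := by
  refine ((hasDerivAt_integral_g x).add
    (((hasDerivAt_cos x).add_const e).div (hasDerivAt_id x) hx)).congr_deriv ?_
  rw [g, if_neg hx, id]
  field_simp
  ring

lemma abs_integral_g_le_of_one_le {x : ℝ} (hx : 1 ≤ x) : |∫ u in (0 : ℝ)..x, g u| ≤ 3 := by
  have h1 := abs_le.1 (abs_integral_g_le_abs_sub 0 1)
  norm_num at h1
  have hd (e : ℝ) (y : ℝ) (hy : y ∈ Set.Ici (1 : ℝ)) :=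
    hasDerivAt_integral_g_add (zero_lt_one.trans_le (Set.mem_Ici.1 hy)).ne' e
  have hc (e : ℝ) : ContinuousOn (fun y => (∫ u in (0 : ℝ)..y, g u) + (cos y + e) / y)
      (Set.Ici 1) := fun y hy => (hd e y hy).continuousAt.continuousWithinAt
  have hu := antitoneOn_of_deriv_nonpos (convex_Ici 1) (hc 1)
    (fun y hy => (hd 1 y (interior_subset hy)).differentiableAt.differentiableWithinAt)
    (fun y hy => by
      rw [(hd 1 y (interior_subset hy)).deriv]
      exact div_nonpos_of_nonpos_of_nonneg (by linarith [neg_one_le_cos y]) (sq_nonneg y))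
    Set.self_mem_Ici hx hx
  have hl := monotoneOn_of_deriv_nonneg (convex_Ici 1) (hc (-1))
    (fun y hy => (hd (-1) y (interior_subset hy)).differentiableAt.differentiableWithinAt)
    (fun y hy => by
      rw [(hd (-1) y (interior_subset hy)).deriv]
      exact div_nonneg (by linarith [cos_le_one y]) (sq_nonneg y))
    Set.self_mem_Ici hx hx
  have hx0 : 0 ≤ x := zero_le_one.trans hx
  have hu' : 0 ≤ (cos x + 1) / x := div_nonneg (by linarith [neg_one_le_cos x]) hx0
  have hl' : (cos x + -1) / x ≤ 0 :=
    div_nonpos_of_nonpos_of_nonneg (by linarith [cos_le_one x]) hx0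
  simp only [div_one] at hu hl
  rw [abs_le]
  constructor <;> linarith [neg_one_le_cos 1, cos_le_one 1]

lemma abs_integral_g_le (x : ℝ) : |∫ u in (0 : ℝ)..x, g u| ≤ 3 := by
  have key {y : ℝ} (hy : 0 ≤ y) : |∫ u in (0 : ℝ)..y, g u| ≤ 3 := by
    rcases le_total 1 y with h | h
    · exact abs_integral_g_le_of_one_le h
    · refine (abs_integral_g_le_abs_sub 0 y).trans ?_
      rw [sub_zero, abs_of_nonneg hy]
      linarith
  rcases le_total 0 x with h | h
  · exact key h
  · have he : (∫ u in (0 : ℝ)..x, g u) = -∫ u in (0 : ℝ)..(-x), g u := by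
      have := intervalIntegral.integral_comp_neg (a := 0) (b := -x) g
      simp only [g_eq_sinc, sinc_neg, neg_neg, neg_zero] at this ⊢
      rw [this, intervalIntegral.integral_symm]
    rw [he, abs_neg]
    exact key (neg_nonneg.2 h)

lemma abs_integral_g_mul_le {p : ℝ} (hp : p ≠ 0) (a b : ℝ) :
    |∫ x in a..b, g (x * p)| ≤ 6 / |p| := by
  rw [intervalIntegral.integral_comp_mul_right g hp, smul_eq_mul, abs_mul, abs_inv, div_eq_inv_mul]
  refine mul_le_mul_of_nonneg_left ?_ (by positivity)
  rw [← intervalIntegral.integral_interval_sub_left (a := 0)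
    (continuous_g.intervalIntegrable _ _) (continuous_g.intervalIntegrable _ _)]
  refine (abs_sub _ _).trans ?_
  linarith [abs_integral_g_le (a * p), abs_integral_g_le (b * p)]

lemma ordConnected_ae_eq_Ioc {S : Set ℝ} (hS : S.OrdConnected) (hne : S.Nonempty)
    (hb : BddBelow S) (ha : BddAbove S) :
    S =ᵐ[volume] Set.Ioc (sInf S) (sSup S) := by
  have hI : Set.Ioo (sInf S) (sSup S) ⊆ S :=
    IsConnected.Ioo_csInf_csSup_subset ⟨hne, hS.isPreconnected⟩ hb ha
  refine Filter.EventuallyLE.antisymm ?_ ?_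
  · exact (subset_Icc_csInf_csSup hb ha).eventuallyLE.trans Ioc_ae_eq_Icc.symm.le
  · exact Ioo_ae_eq_Ioc.symm.le.trans hI.eventuallyLE

lemma abs_setIntegral_g_mul_le {S : Set ℝ} (hS : S.OrdConnected) {R : ℝ} (hR : 0 ≤ R)
    (hSR : S ⊆ Set.Icc (-R) R) {p : ℝ} (hp : p ≠ 0) :
    |∫ x in S, g (x * p)| ≤ min (6 / |p|) (2 * R) := by
  rcases S.eq_empty_or_nonempty with rfl | hne
  · simp only [Measure.restrict_empty, integral_zero_measure, abs_zero]
    positivity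
  have hb : BddBelow S := bddBelow_Icc.mono hSR
  have ha : BddAbove S := bddAbove_Icc.mono hSR
  have hle : sInf S ≤ sSup S := csInf_le_csSup hne hb ha
  rw [setIntegral_congr_set (ordConnected_ae_eq_Ioc hS hne hb ha),
    ← intervalIntegral.integral_of_le hle]
  refine le_min (abs_integral_g_mul_le hp _ _) ?_
  have h := intervalIntegral.norm_integral_le_of_norm_le_const (a := sInf S) (b := sSup S)
    (f := fun x => g (x * p)) (C := 1) fun x _ => abs_g_le_one _
  rw [Real.norm_eq_abs, one_mul, abs_of_nonneg (sub_nonneg.2 hle)] at h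
  have h1 : -R ≤ sInf S := le_csInf hne fun x hx => (hSR hx).1
  have h2 : sSup S ≤ R := csSup_le hne fun x hx => (hSR hx).2
  linarith

lemma min_le_rpow_mul_rpow {a b s : ℝ} (ha : 0 < a) (hb : 0 < b) (hs : 0 ≤ s) (hs1 : s ≤ 1) :
    min a b ≤ a ^ (1 - s) * b ^ s := by
  have hm : 0 < min a b := lt_min ha hb
  calc min a b = min a b ^ (1 - s) * min a b ^ s := by
        rw [← rpow_add hm, sub_add_cancel, rpow_one]
    _ ≤ a ^ (1 - s) * b ^ s := by
        refine mul_le_mul (rpow_le_rpow hm.le (min_le_left _ _) (by linarith))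
          (rpow_le_rpow hm.le (min_le_right _ _) hs) ?_ ?_ <;> positivity

lemma integrableOn_abs_rpow {s : ℝ} (hs : 0 < s) (R : ℝ) :
    IntegrableOn (fun u : ℝ => |u| ^ (s - 1)) (Set.Icc (-R) R) := by
  rcases lt_or_ge R 0 with h | h
  · simp [Set.Icc_eq_empty (show ¬ -R ≤ R by linarith)]
  have h0 : IntervalIntegrable (fun u : ℝ => |u| ^ (s - 1)) volume 0 R := by
    refine (intervalIntegral.intervalIntegrable_rpow' (a := 0) (b := R)
      (show -1 < s - 1 by linarith)).congr fun u hu => ?_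
    rw [Set.uIoc_of_le h] at hu
    simp only [abs_of_pos hu.1]
  have h1 : IntervalIntegrable (fun u : ℝ => |u| ^ (s - 1)) volume (-R) 0 := by
    simpa using ((IntervalIntegrable.iff_comp_neg (by simp)).1 h0).symm
  rw [integrableOn_Icc_iff_integrableOn_Ioc,
    ← intervalIntegrable_iff_integrableOn_Ioc_of_le (by linarith)]
  exact h1.trans h0

lemma integral_abs_rpow {s R : ℝ} (hs : 0 < s) (hR : 0 ≤ R) :
    ∫ u in Set.Icc (-R) R, |u| ^ (s - 1) = 2 * (R ^ s / s) := by
  have h : (Set.Icc (-R) R).indicator (fun u : ℝ => |u| ^ (s - 1)) =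
      fun u => (Set.Iic R).indicator (fun v : ℝ => v ^ (s - 1)) |u| := by
    ext u
    simp [Set.indicator_apply, abs_le]
  rw [← integral_indicator measurableSet_Icc, h, integral_comp_abs,
    setIntegral_indicator measurableSet_Iic, Set.Ioi_inter_Iic, ← intervalIntegral.integral_of_le hR,
    integral_rpow (Or.inl (by linarith)), sub_add_cancel, zero_rpow hs.ne', sub_zero]

lemma integral_abs_rpow_of_lt {s r R : ℝ} (hs : 0 < s) (hs1 : s ≤ 1) (hr : 0 < r) (hR : 0 ≤ R) :
    ∫ u in {u : ℝ | r < |u|} ∩ Set.Icc (-R) R, |u| ^ (s - 1) ≤ 2 * R * r ^ (s - 1) := by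
  have hm : MeasurableSet {u : ℝ | r < |u|} := measurableSet_lt measurable_const measurable_norm
  calc ∫ u in {u : ℝ | r < |u|} ∩ Set.Icc (-R) R, |u| ^ (s - 1)
      ≤ ∫ u in {u : ℝ | r < |u|} ∩ Set.Icc (-R) R, r ^ (s - 1) := by
        refine setIntegral_mono_on ((integrableOn_abs_rpow hs R).mono_set Set.inter_subset_right)
          ?_ (hm.inter measurableSet_Icc) fun u hu => ?_
        · exact (integrableOn_const_iff).2 (Or.inr
            ((measure_mono Set.inter_subset_right).trans_lt measure_Icc_lt_top))
        · exact rpow_le_rpow_of_nonpos hr (le_of_lt hu.1) (by linarith)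
    _ ≤ ∫ u in Set.Icc (-R) R, r ^ (s - 1) := by
        refine setIntegral_mono_set (by simp) ?_ Set.inter_subset_right.eventuallyLE
        exact Filter.Eventually.of_forall fun u => by positivity
    _ = 2 * R * r ^ (s - 1) := by
        rw [setIntegral_const, smul_eq_mul, Real.volume_real_Icc_of_le (by linarith)]
        ring

lemma abs_setIntegral_g_prod_le_of_slice {n : ℕ} (j : Fin (n + 1)) {A : Set (Fin (n + 1) → ℝ)}
    (hA : MeasurableSet A) (hA' : volume A ≠ ⊤) {F : (Fin n → ℝ) → ℝ} (hF : Integrable F)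
    (h : ∀ᵐ y : Fin n → ℝ, |∫ x in {x | j.insertNth x y ∈ A}, g (x * ∏ l, y l)| ≤ F y) :
    |∫ t in A, g (∏ i, t i)| ≤ ∫ y, F y := by
  set e := (MeasurableEquiv.piFinSuccAbove (fun _ : Fin (n + 1) => ℝ) j).symm
  have he : MeasurePreserving e := (volume_preserving_piFinSuccAbove (fun _ => ℝ) j).symm
  have hcont : Continuous fun t : Fin (n + 1) → ℝ => g (∏ i, t i) :=
    continuous_g.comp (by fun_prop)
  have hInt : Integrable (A.indicator fun t => g (∏ i, t i)) := by
    rw [integrable_indicator_iff hA]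
    exact Measure.integrableOn_of_bounded hA' hcont.aestronglyMeasurable
      (M := 1) (Filter.Eventually.of_forall fun t => abs_g_le_one _)
  have hInt' : Integrable (fun z => A.indicator (fun t => g (∏ i, t i)) (e z)) :=
    (he.integrable_comp_emb e.measurableEmbedding).2 hInt
  rw [← integral_indicator hA, ← he.integral_comp' (g := A.indicator fun t => g (∏ i, t i)),
    Measure.volume_eq_prod, integral_prod_symm _ hInt', ← Real.norm_eq_abs]
  refine norm_integral_le_of_norm_le hF ?_
  filter_upwards [h] with y hy
  have hslice : MeasurableSet {x | j.insertNth x y ∈ A} :=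
    (e.measurable.comp (measurable_id.prodMk measurable_const)) hA
  rw [← integral_indicator hslice] at hy
  refine (congrArg abs (integral_congr_ae (Filter.Eventually.of_forall fun x => ?_))).trans_le hy
  change A.indicator (fun t => g (∏ i, t i)) (j.insertNth x y) = _
  have hval : g (∏ i, (j.insertNth x y : Fin (n + 1) → ℝ) i) = g (x * ∏ l, y l) := by
    simp only [Fin.prod_univ_succAbove _ j, Fin.insertNth_apply_same,
      Fin.insertNth_apply_succAbove]
  by_cases hx : x ∈ {x : ℝ | (j.insertNth x y : Fin (n + 1) → ℝ) ∈ A}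
  · rw [Set.indicator_of_mem hx, Set.indicator_of_mem (s := A) hx, hval]
  · rw [Set.indicator_of_notMem hx, Set.indicator_of_notMem (s := A) hx]

lemma abs_setIntegral_g_prod_le {n : ℕ} {i j : Fin (n + 2)} (hij : i ≠ j)
    {A : Set (Fin (n + 2) → ℝ)} (hA : MeasurableSet A) {r R s : ℝ} (hr : 0 < r) (hR : 0 < R)
    (hs : 0 < s) (hs1 : s ≤ 1) (hAR : A ⊆ Set.Icc (fun _ => -R) (fun _ => R))
    (hAr : ∀ t ∈ A, r < |t i|)
    (hconn : ∀ y : Fin (n + 1) → ℝ, {x : ℝ | j.insertNth x y ∈ A}.OrdConnected) :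
    |∫ t in A, g (∏ l, t l)| ≤
      6 ^ (1 - s) * (2 * R) ^ s * (2 * R * r ^ (s - 1) * (2 * (R ^ s / s)) ^ n) := by
  obtain ⟨l₀, rfl⟩ := Fin.exists_succAbove_eq hij
  set S : Fin (n + 1) → Set ℝ := fun l =>
    if l = l₀ then {u : ℝ | r < |u|} ∩ Set.Icc (-R) R else Set.Icc (-R) R with hSdef
  have hSR (l) : S l ⊆ Set.Icc (-R) R := by
    simp only [hSdef]
    split_ifs
    · exact Set.inter_subset_right
    · exact subset_rfl
  have hSm (l) : MeasurableSet (S l) := by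
    simp only [hSdef]
    split_ifs
    · exact (measurableSet_lt measurable_const measurable_norm).inter measurableSet_Icc
    · exact measurableSet_Icc
  set h : Fin (n + 1) → ℝ → ℝ := fun l => (S l).indicator fun u => |u| ^ (s - 1)
  have h0 (l u) : 0 ≤ h l u := Set.indicator_nonneg (fun u _ => by positivity) u
  have hInt (l) : Integrable (h l) :=
    (integrable_indicator_iff (hSm l)).2 ((integrableOn_abs_rpow hs R).mono_set (hSR l))
  have hle : ∏ l, ∫ u, h l u ≤ 2 * R * r ^ (s - 1) * (2 * (R ^ s / s)) ^ n := by
    rw [Fin.prod_univ_succAbove _ l₀]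
    have h1 : ∫ u, h l₀ u ≤ 2 * R * r ^ (s - 1) := by
      rw [integral_indicator (hSm _)]
      simpa [hSdef] using integral_abs_rpow_of_lt hs hs1 hr hR.le
    have h2 (m : Fin n) : ∫ u, h (l₀.succAbove m) u = 2 * (R ^ s / s) := by
      rw [integral_indicator (hSm _)]
      simpa [hSdef, Fin.succAbove_ne] using integral_abs_rpow hs hR.le
    simp only [h2, Finset.prod_const, Finset.card_univ, Fintype.card_fin]
    gcongr
  have hvol : volume A ≠ ⊤ := ((measure_mono hAR).trans_lt isCompact_Icc.measure_lt_top).ne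
  calc |∫ t in A, g (∏ l, t l)|
      ≤ ∫ y : Fin (n + 1) → ℝ, 6 ^ (1 - s) * (2 * R) ^ s * ∏ l, h l (y l) := by
        refine abs_setIntegral_g_prod_le_of_slice j hA hvol
          ((Integrable.fintype_prod_dep hInt).const_mul _) ?_
        have hne : ∀ᵐ y : Fin (n + 1) → ℝ, ∀ l, y l ≠ 0 :=
          ae_all_iff.2 fun l => Measure.ae_eval_ne (μ := fun _ => (volume : Measure ℝ)) l 0
        filter_upwards [hne] with y hy
        have hp : ∏ l, y l ≠ 0 := Finset.prod_ne_zero_iff.2 fun l _ => hy l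
        by_cases hyS : ∀ l, y l ∈ S l
        · have hprod : ∏ l, h l (y l) = |∏ l, y l| ^ (s - 1) := by
            rw [Finset.abs_prod, ← Real.finsetProd_rpow _ _ fun l _ => abs_nonneg _]
            exact Finset.prod_congr rfl fun l _ => Set.indicator_of_mem (hyS l) _
          have hxR : {x : ℝ | j.insertNth x y ∈ A} ⊆ Set.Icc (-R) R := fun x hx => by
            have := hAR hx
            simpa using And.intro (this.1 j) (this.2 j)
          have hp' : 0 < |∏ l, y l| := abs_pos.2 hp
          refine (abs_setIntegral_g_mul_le (hconn y) hR.le hxR hp).trans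
            ((min_le_rpow_mul_rpow (by positivity) (by positivity) hs.le hs1).trans_eq ?_)
          rw [hprod, div_rpow (by norm_num) hp'.le, div_eq_mul_inv, ← rpow_neg hp'.le, neg_sub]
          ring
        · obtain ⟨l, hl⟩ := not_forall.1 hyS
          have hempty : {x : ℝ | j.insertNth x y ∈ A} = ∅ := by
            refine Set.eq_empty_of_forall_notMem fun x hx => hl ?_
            have h1 := hAR hx
            have h2 : y l ∈ Set.Icc (-R) R := by
              simpa using And.intro (h1.1 (j.succAbove l)) (h1.2 (j.succAbove l))
            simp only [hSdef]
            split_ifs with hll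
            · subst hll
              exact ⟨by simpa using hAr _ hx, h2⟩
            · exact h2
          rw [hempty, Measure.restrict_empty, integral_zero_measure, abs_zero]
          have := Finset.prod_nonneg fun l (_ : l ∈ Finset.univ) => h0 l (y l)
          positivity
    _ = 6 ^ (1 - s) * (2 * R) ^ s * ∏ l, ∫ u, h l u := by
        rw [integral_const_mul, integral_fintype_prod_volume_eq_prod]
    _ ≤ _ := by gcongr

lemma mem_Icc_neg_iff {ι : Type*} {r : ℝ} {t : ι → ℝ} :
    t ∈ Set.Icc (fun _ => -r) (fun _ => r) ↔ ∀ i, |t i| ≤ r := by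
  simp only [Set.mem_Icc, Pi.le_def, abs_le, forall_and]

/-- The points of `D` whose first coordinate exceeding `r` in absolute value is the `i`-th. -/
def firstExit {k : ℕ} (D : Set (Fin k → ℝ)) (r : ℝ) (i : Fin k) : Set (Fin k → ℝ) :=
  {t | t ∈ D ∧ r < |t i| ∧ ∀ l < i, |t l| ≤ r}

lemma iUnion_firstExit {k : ℕ} (D : Set (Fin k → ℝ)) (r : ℝ) :
    ⋃ i, firstExit D r i = D \ Set.Icc (fun _ => -r) (fun _ => r) := by
  ext t
  simp only [Set.mem_iUnion, firstExit, Set.mem_ofPred_eq, Set.mem_sdiff, mem_Icc_neg_iff]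
  constructor
  · rintro ⟨i, hD, hi, -⟩
    exact ⟨hD, fun h => (h i).not_gt hi⟩
  · rintro ⟨hD, h⟩
    obtain ⟨i, hi, hmin⟩ := WellFounded.has_min (wellFounded_lt (α := Fin k))
      {i | r < |t i|} (by simpa [Set.Nonempty] using h)
    exact ⟨i, hD, hi, fun l hl => not_lt.1 fun hlt => hmin l hlt hl⟩

lemma pairwise_disjoint_firstExit {k : ℕ} (D : Set (Fin k → ℝ)) (r : ℝ) :
    Pairwise (Function.onFun Disjoint (firstExit D r)) := by
  intro i j hij
  refine Set.disjoint_left.2 ?_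
  rintro t ⟨-, hi, hi'⟩ ⟨-, hj, hj'⟩
  rcases hij.lt_or_gt with h | h
  · exact (hj' i h).not_gt hi
  · exact (hi' j h).not_gt hj

lemma measurableSet_firstExit {k : ℕ} {D : Set (Fin k → ℝ)} (hD : MeasurableSet D) (r : ℝ)
    (i : Fin k) : MeasurableSet (firstExit D r i) := by
  have h (l : Fin k) : Measurable fun t : Fin k → ℝ => |t l| :=
    measurable_norm.comp (measurable_pi_apply l)
  have : firstExit D r i =
      D ∩ ({t | r < |t i|} ∩ ⋂ l, ⋂ (_ : l < i), {t : Fin k → ℝ | |t l| ≤ r}) := by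
    ext t
    simp only [firstExit, Set.mem_inter_iff, Set.mem_iInter, Set.mem_ofPred_eq]
  rw [this]
  exact hD.inter ((measurableSet_lt measurable_const (h i)).inter
    (MeasurableSet.iInter fun l => MeasurableSet.iInter fun _ =>
      measurableSet_le (h l) measurable_const))

lemma ordConnected_slice_firstExit {n : ℕ} {D : Set (Fin (n + 1) → ℝ)} (hD : Convex ℝ D) (r : ℝ)
    {i j : Fin (n + 1)} (hij : i ≠ j) (y : Fin n → ℝ) :
    {x : ℝ | j.insertNth x y ∈ firstExit D r i}.OrdConnected := by
  refine Convex.ordConnected (𝕜 := ℝ) fun x₁ h₁ x₂ h₂ a b ha hb hab => ?_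
  obtain ⟨l₀, rfl⟩ := Fin.exists_succAbove_eq hij
  have hcomb : (j.insertNth (a • x₁ + b • x₂) y : Fin (n + 1) → ℝ) =
      a • (j.insertNth x₁ y : Fin (n + 1) → ℝ) + b • (j.insertNth x₂ y : Fin (n + 1) → ℝ) := by
    ext m
    rcases Fin.eq_self_or_eq_succAbove j m with rfl | ⟨m, rfl⟩
    · simp
    · simp [← add_mul, hab]
  refine ⟨?_, ?_, fun l hl => ?_⟩
  · rw [hcomb]
    exact hD h₁.1 h₂.1 ha hb hab
  · simpa using h₁.2.1
  · have e₁ := h₁.2.2 l hl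
    have e₂ := h₂.2.2 l hl
    rw [hcomb, ← Set.mem_ofPred_eq (p := fun u : ℝ => |u| ≤ r)]
    have hconv : Convex ℝ {u : ℝ | |u| ≤ r} := by
      simp only [abs_le]
      exact convex_Icc (-r) r
    exact hconv e₁ e₂ ha hb hab

lemma abs_setIntegral_annulus_le {n : ℕ} {D : Set (Fin (n + 2) → ℝ)} (hD : IsCompact D)
    (hconv : Convex ℝ D) {r R s : ℝ} (hr : 0 < r) (hR : 0 < R) (hs : 0 < s) (hs1 : s ≤ 1)
    (hDR : D ⊆ Set.Icc (fun _ => -R) (fun _ => R)) :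
    |∫ t in D \ Set.Icc (fun _ => -r) (fun _ => r), g (∏ i, t i)| ≤
      (n + 2) * (6 ^ (1 - s) * (2 * R) ^ s *
        (2 * R * r ^ (s - 1) * (2 * (R ^ s / s)) ^ n)) := by
  have hcont : Continuous fun t : Fin (n + 2) → ℝ => g (∏ i, t i) :=
    continuous_g.comp (by fun_prop)
  have hsub (i) : firstExit D r i ⊆ D := fun t ht => ht.1
  rw [← iUnion_firstExit, integral_iUnion_fintype
    (fun i => measurableSet_firstExit hD.measurableSet r i) (pairwise_disjoint_firstExit D r)
    fun i => (hcont.continuousOn.integrableOn_compact hD).mono_set (hsub i)]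
  refine (Finset.abs_sum_le_sum_abs _ _).trans
    ((Finset.sum_le_card_nsmul _ _ _ fun i _ => ?_).trans_eq
      (by rw [Finset.card_univ, Fintype.card_fin, nsmul_eq_mul]; push_cast; rfl))
  obtain ⟨j, hj⟩ := exists_ne i
  exact abs_setIntegral_g_prod_le hj.symm (measurableSet_firstExit hD.measurableSet r i) hr hR hs
    hs1 ((hsub i).trans hDR) (fun t ht => ht.2.1)
    fun y => ordConnected_slice_firstExit hconv r hj.symm y

lemma mul_rpow_inv_log_le {a N : ℝ} (ha : 0 ≤ a) (hN : exp 1 ≤ N) :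
    (a * N) ^ (log N)⁻¹ ≤ (1 + a) * exp 1 := by
  have hN0 : 0 < N := (exp_pos 1).trans_le hN
  have hlog : 1 ≤ log N := (le_log_iff_exp_le hN0).2 hN
  rw [mul_rpow ha hN0.le]
  have h1 : N ^ (log N)⁻¹ = exp 1 := by
    rw [rpow_def_of_pos hN0, mul_inv_cancel₀ (by linarith)]
  rw [h1]
  refine mul_le_mul_of_nonneg_right ?_ (exp_pos 1).le
  calc a ^ (log N)⁻¹ ≤ (1 + a) ^ (log N)⁻¹ := rpow_le_rpow ha (by linarith) (by positivity)
    _ ≤ (1 + a) ^ (1 : ℝ) := rpow_le_rpow_of_exponent_le (by linarith) (inv_le_one_of_one_le₀ hlog)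
    _ = 1 + a := rpow_one _

/-- Fix `k ≥ 2` and `0 < c < C`. There is `C̃ > 0` such that for all sufficiently large `N`
and every compact convex `D` with `[-cN, cN]^k ⊆ D ⊆ [-CN, CN]^k`, the integral of
`g (t₁ ⋯ t_k)` over `D \ [-cN, cN]^k` is at most `C̃ · (log N)^(k-2)` in absolute value. -/
theorem annulus_integral_upper_bound (k : ℕ) (hk : 2 ≤ k) (c C : ℝ)
    (hc : 0 < c) (hcC : c < C) :
    ∃ Ct : ℝ, 0 < Ct ∧ ∃ N₀ : ℝ, ∀ N : ℝ, N₀ ≤ N → ∀ D : Set (Fin k → ℝ),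
      IsCompact D → Convex ℝ D →
      Set.Icc (fun _ : Fin k => -(c * N)) (fun _ : Fin k => c * N) ⊆ D →
      D ⊆ Set.Icc (fun _ : Fin k => -(C * N)) (fun _ : Fin k => C * N) →
      |∫ t in D \ Set.Icc (fun _ : Fin k => -(c * N)) (fun _ : Fin k => c * N),
          g (∏ i, t i)| ≤ Ct * (Real.log N) ^ (k - 2) := by
  obtain ⟨n, rfl⟩ := Nat.exists_eq_add_of_le' hk
  have hC : 0 < C := hc.trans hcC
  refine ⟨(n + 2) * (6 * ((1 + 2 * C) * exp 1) *
    (2 * (C / c) * ((1 + c) * exp 1) * (2 * ((1 + C) * exp 1)) ^ n)), by positivity, exp 1, ?_⟩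
  intro N hN D hD hconv _ hDC
  have hN0 : 0 < N := (exp_pos 1).trans_le hN
  have hlog : 1 ≤ log N := (le_log_iff_exp_le hN0).2 hN
  have hs : 0 < (log N)⁻¹ := by positivity
  have hs1 : (log N)⁻¹ ≤ 1 := inv_le_one_of_one_le₀ hlog
  refine (abs_setIntegral_annulus_le hD hconv (mul_pos hc hN0) (mul_pos hC hN0) hs hs1 hDC).trans ?_
  have h6 : (6 : ℝ) ^ (1 - (log N)⁻¹) ≤ 6 :=
    (rpow_le_rpow_of_exponent_le (by norm_num) (by linarith)).trans_eq (rpow_one 6)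
  have h2C := mul_rpow_inv_log_le (show 0 ≤ 2 * C by positivity) hN
  rw [mul_assoc] at h2C
  have hc' : 2 * (C * N) * (c * N) ^ ((log N)⁻¹ - 1) ≤ 2 * (C / c) * ((1 + c) * exp 1) := by
    rw [rpow_sub_one (by positivity)]
    calc 2 * (C * N) * ((c * N) ^ (log N)⁻¹ / (c * N))
        = 2 * (C / c) * (c * N) ^ (log N)⁻¹ := by field_simp
      _ ≤ _ := by gcongr; exact mul_rpow_inv_log_le hc.le hN
  have hC' : 2 * ((C * N) ^ (log N)⁻¹ / (log N)⁻¹) ≤ 2 * ((1 + C) * exp 1) * log N := by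
    rw [div_inv_eq_mul, ← mul_assoc]
    gcongr
    exact mul_rpow_inv_log_le hC.le hN
  calc _ ≤ (n + 2) * (6 * ((1 + 2 * C) * exp 1) * (2 * (C / c) * ((1 + c) * exp 1) *
        (2 * ((1 + C) * exp 1) * log N) ^ n)) := by gcongr
    _ = _ := by
        rw [Nat.add_sub_cancel, mul_pow _ (log N)]
        ring
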